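/- For every QBC Φ and every m ≥ 2, the set of partial assignments H(Φ, Π_m) is semicompletion-closed. -/

import Mathlib

/-! Framework for quantified Boolean circuits (QBCs), QU-resolution,
relaxations, and the prover–delayer game, following Chen,
"Proof Complexity Modulo the Polynomial Hierarchy". -/

/-- Quantifiers. -/
inductive Quant where
  | all : Quant
  | ex : Quant
deriving DecidableEq

/-- A partial assignment of Boolean values to (numbered) propositional
variables.  Via the correspondence `C ↔ assign(C)`, partial assignments also
represent clauses (the clause `clause(a)` is the unique clause with variable
set `dom a` falsified by `a`); we freely identify the two. -/
abbrev PA : Type := ℕ → Option Bool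

/-- The everywhere-undefined partial assignment (= the empty clause). -/
def emptyPA : PA := fun _ => none

/-- `g` extends the partial assignment `f`. -/
def ExtendsPA (g f : PA) : Prop := ∀ v b, f v = some b → g v = some b

/-- A total assignment `g` extends a partial assignment `f`; when `f`
represents a clause, this says `g` falsifies that clause. -/
def TotalExtends (g : ℕ → Bool) (f : PA) : Prop := ∀ v b, f v = some b → g v = b

/-- A partial assignment `r` satisfies a clause `C` (i.e. makes some literal
of `C` true). -/
def SatisfiedBy (r : PA) (C : PA) : Prop := ∃ v b, C v = some b ∧ r v = some (!b)

/-- A quantified Boolean circuit: a quantifier prefix (a list of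
quantifier/variable pairs) together with a Boolean function on total
assignments, represented as a predicate. -/
structure QBC where
  pfx : List (Quant × ℕ)
  matrix : (ℕ → Bool) → Prop

/-- The variables of the prefix of a QBC. -/
def QBC.vars (Φ : QBC) : List ℕ := Φ.pfx.map Prod.snd

/-- Well-formedness of a QBC: the prefix has no repeated variables, and the
matrix depends only on the values of the prefix variables. -/
def QBC.WellFormed (Φ : QBC) : Prop :=
  Φ.vars.Nodup ∧
  ∀ f g : ℕ → Bool, (∀ v ∈ Φ.vars, f v = g v) → (Φ.matrix f ↔ Φ.matrix g)

/-- Standard semantics of a quantifier prefix over a matrix, starting from a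
base assignment. -/
def evalQ : List (Quant × ℕ) → ((ℕ → Bool) → Prop) → (ℕ → Bool) → Prop
  | [], φ, g => φ g
  | (Quant.ex, v) :: P, φ, g => ∃ b, evalQ P φ (Function.update g v b)
  | (Quant.all, v) :: P, φ, g => ∀ b, evalQ P φ (Function.update g v b)

/-- Truth of a QBC. -/
def QBC.IsTrue (Φ : QBC) : Prop := ∀ g, evalQ Φ.pfx Φ.matrix g

/-- Falsity of a QBC. -/
def QBC.IsFalse (Φ : QBC) : Prop := ¬ Φ.IsTrue

/-- The existentially quantified variables of a prefix. -/
def existVars (P : List (Quant × ℕ)) : List ℕ :=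
  (P.filter fun p => decide (p.1 = Quant.ex)).map Prod.snd

/-- The universally quantified variables of a prefix. -/
def univVars (P : List (Quant × ℕ)) : List ℕ :=
  (P.filter fun p => decide (p.1 = Quant.all)).map Prod.snd

/-- The relation `u ⪯ v` of a prefix: `vᵢ ⪯ vⱼ` iff `i ≤ j`, or `j < i` and
`Qⱼ = Qⱼ₊₁ = ⋯ = Qᵢ`. -/
def preceq (P : List (Quant × ℕ)) (u v : ℕ) : Prop :=
  ∃ i j : ℕ, (P[i]?).map Prod.snd = some u ∧ (P[j]?).map Prod.snd = some v ∧
    (i ≤ j ∨ (j < i ∧ ∀ k, j ≤ k → k ≤ i → (P[k]?).map Prod.fst = (P[j]?).map Prod.fst))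

/-- `u` strictly precedes `v` (`u ⪯ v` and not `v ⪯ u`). -/
def strictPrec (P : List (Quant × ℕ)) (u v : ℕ) : Prop :=
  preceq P u v ∧ ¬ preceq P v u

/-- dom(f) ⪯ y : every variable on which `f` is defined is `⪯ y`. -/
def domPrec (P : List (Quant × ℕ)) (f : PA) (y : ℕ) : Prop :=
  ∀ u, f u ≠ none → preceq P u y

/-- An ∃-strategy: a family of response functions for the existential
variables, each depending only on the universal variables strictly
preceding it. -/
def IsExStrategy (Φ : QBC) (σ : ℕ → (ℕ → Bool) → Bool) : Prop :=
  ∀ x ∈ existVars Φ.pfx, ∀ τ τ' : ℕ → Bool,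
    (∀ y ∈ univVars Φ.pfx, strictPrec Φ.pfx y x → τ y = τ' y) → σ x τ = σ x τ'

/-- The total assignment `⟨σ, τ⟩` induced by an ∃-strategy `σ` and an
assignment `τ` to the universal variables. -/
def playE (Φ : QBC) (σ : ℕ → (ℕ → Bool) → Bool) (τ : ℕ → Bool) : ℕ → Bool :=
  fun v => if v ∈ existVars Φ.pfx then σ v τ else τ v

/-- `σ` is a winning ∃-strategy of the prefix of `Φ` for the matrix `M`. -/
def ModelOf (Φ : QBC) (M : (ℕ → Bool) → Prop) (σ : ℕ → (ℕ → Bool) → Bool) : Prop :=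
  IsExStrategy Φ σ ∧ ∀ τ : ℕ → Bool, M (playE Φ σ τ)

/-- A model of `Φ` (a winning ∃-strategy). -/
def QBC.Model (Φ : QBC) (σ : ℕ → (ℕ → Bool) → Bool) : Prop :=
  ModelOf Φ Φ.matrix σ

/-- `σ` is a model of `P : C`, where `P` is the prefix of `Φ` and `C` is a
clause (represented by its falsifying assignment). -/
def ModelOfClause (Φ : QBC) (σ : ℕ → (ℕ → Bool) → Bool) (C : PA) : Prop :=
  ModelOf Φ (fun g => ¬ TotalExtends g C) σ

/-- `C` is an axiom of `Φ`: a clause on the variables of `Φ` such that every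
model of `Φ` is a model of `P : C`. -/
def IsAxiom (Φ : QBC) (C : PA) : Prop :=
  (∀ v, C v ≠ none → v ∈ Φ.vars) ∧ ∀ σ, Φ.Model σ → ModelOfClause Φ σ C

/-- An axiom set of `Φ`. -/
def IsAxiomSet (Φ : QBC) (H : Set PA) : Prop := ∀ C ∈ H, IsAxiom Φ C

/-- A ∀-strategy: response functions for the universal variables, each
depending only on the existential variables strictly preceding it. -/
def IsUnivStrategy (Φ : QBC) (τ : ℕ → (ℕ → Bool) → Bool) : Prop :=
  ∀ y ∈ univVars Φ.pfx, ∀ σ σ' : ℕ → Bool,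
    (∀ x ∈ existVars Φ.pfx, strictPrec Φ.pfx x y → σ x = σ' x) → τ y σ = τ y σ'

/-- The total assignment `⟨τ, σ⟩` induced by a ∀-strategy `τ` and an
assignment `σ` to the existential variables. -/
def playU (Φ : QBC) (τ : ℕ → (ℕ → Bool) → Bool) (σ : ℕ → Bool) : ℕ → Bool :=
  fun v => if v ∈ univVars Φ.pfx then τ v σ else σ v

/-- A winning ∀-strategy: every play falsifies the matrix. -/
def WinningUnivStrategy (Φ : QBC) (τ : ℕ → (ℕ → Bool) → Bool) : Prop :=
  IsUnivStrategy Φ τ ∧ ∀ σ : ℕ → Bool, ¬ Φ.matrix (playU Φ τ σ)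

/-- `C` is obtainable from `D` by ∀-elimination (relative to prefix `P`):
`C = D ∖ {L}` for a literal `L` on a universal variable `y` with
`vars(C) ⪯ y`.  In assignment form: `D` is `C` additionally defined on `y`. -/
def ForallElim (P : List (Quant × ℕ)) (C D : PA) : Prop :=
  ∃ y b, y ∈ univVars P ∧ C y = none ∧ D = Function.update C y (some b) ∧
    ∀ u, C u ≠ none → preceq P u y

/-- `γ` is the resolvent of `α` and `β` on variable `v` (in falsifying
assignment form: `α` and `β` carry complementary literals on `v`, `γ` is
the union of the remainders, which must be a clause). -/
def IsResolvent (γ α β : PA) (v : ℕ) : Prop :=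
  ∃ b, α v = some b ∧ β v = some (!b) ∧ γ v = none ∧
    (∀ u, u ≠ v → γ u = (α u).elim (β u) some) ∧
    (∀ u, u ≠ v → ∀ b₁ b₂, α u = some b₁ → β u = some b₂ → b₁ = b₂)

/-- A step in a QU-resolution proof: an axiom, a ∀-elimination (annotated with
the index of its source), or a resolution step (annotated with the indices of
its two sources and the resolved variable). -/
inductive QUStep where
  | ax (C : PA)
  | elim (C : PA) (src : ℕ)
  | res (C : PA) (src₁ src₂ : ℕ) (v : ℕ)

/-- The clause of a proof step. -/
def QUStep.clause : QUStep → PA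
  | .ax C => C
  | .elim C _ => C
  | .res C _ _ _ => C

/-- The clause at position `i` of a proof. -/
def stepClause? (L : List QUStep) (i : ℕ) : Option PA := (L[i]?).map QUStep.clause

/-- Validity of the `i`-th step of a proof from axiom set `H`. -/
def validStep (P : List (Quant × ℕ)) (H : Set PA) (L : List QUStep) (i : ℕ) : Prop :=
  match L[i]? with
  | none => True
  | some (.ax C) => C ∈ H
  | some (.elim C j) => j < i ∧ ∃ D, stepClause? L j = some D ∧ ForallElim P C D
  | some (.res C j k v) => j < i ∧ k < i ∧
      ∃ α β, stepClause? L j = some α ∧ stepClause? L k = some β ∧ IsResolvent C α β v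

/-- A QU-resolution proof of `Φ` from axiom set `H`. -/
def IsQUProof (Φ : QBC) (H : Set PA) (L : List QUStep) : Prop :=
  ∀ i, validStep Φ.pfx H L i

/-- A QU-resolution falsity proof: a proof ending with the empty clause. -/
def IsFalsityProof (Φ : QBC) (H : Set PA) (L : List QUStep) : Prop :=
  IsQUProof Φ H L ∧ (L.getLast?).map QUStep.clause = some emptyPA

/-- The clause `C` appears in the proof `L`. -/
def AppearsIn (L : List QUStep) (C : PA) : Prop := ∃ i, stepClause? L i = some C

/-- The edge relation of the graph `G(π)`: an edge from each clause occurrence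
to the clause occurrence(s) from which it is derived. -/
def edge (L : List QUStep) (i j : ℕ) : Prop :=
  match L[i]? with
  | some (.elim _ s) => j = s
  | some (.res _ s t _) => j = s ∨ j = t
  | _ => False

/-- A sink (leaf) of `G(π)`: a vertex with no outgoing edges. -/
def isSink (L : List QUStep) (i : ℕ) : Prop := i < L.length ∧ ∀ j, ¬ edge L i j

/-- The proof is tree-like: `G(π)` is a tree (each vertex has at most one
incoming edge; acyclicity holds automatically since edges decrease indices). -/
def TreeLike (L : List QUStep) : Prop := ∀ j : ℕ, {i | edge L i j}.Subsingleton

-- The prefix `P[a]`: the variables of `dom a` are removed, and the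
-- quantifier of every variable strictly preceding some variable of `dom a`
-- (equivalently, every `v` with `v ⪯ last(a)` and not `last(a) ⪯ v`) is
-- changed to `∃`.
open Classical in
noncomputable def instPrefix (P : List (Quant × ℕ)) (a : PA) : List (Quant × ℕ) :=
  (P.filter fun p => (a p.2).isNone).map fun p =>
    (if ∃ u, a u ≠ none ∧ strictPrec P p.2 u then Quant.ex else p.1, p.2)

/-- Overriding a total assignment by a partial assignment. -/
def override (a : PA) (g : ℕ → Bool) : ℕ → Bool := fun v => (a v).getD (g v)

/-- The instantiated QBC `Φ[a]` = `P[a] : φ[a]`. -/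
noncomputable def QBC.inst (Φ : QBC) (a : PA) : QBC :=
  ⟨instPrefix Φ.pfx a, fun g => Φ.matrix (override a g)⟩

/-- `P'` is a relaxation of the prefix `P`: a permutation of `P` such that
`y ⪯ x` implies `y ⪯' x` for every universal `y` and existential `x`. -/
def IsRelaxationPfx (P P' : List (Quant × ℕ)) : Prop :=
  P.Perm P' ∧ ∀ y ∈ univVars P, ∀ x ∈ existVars P, preceq P y x → preceq P' y x

/-- `Φ'` is a relaxation of the QBC `Φ`. -/
def IsRelaxation (Φ Φ' : QBC) : Prop :=
  IsRelaxationPfx Φ.pfx Φ'.pfx ∧ Φ'.matrix = Φ.matrix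

/-- Negation of a quantifier. -/
def Quant.neg : Quant → Quant
  | .all => .ex
  | .ex => .all

/-- `isAltFrom q i qs`: the quantifier string `qs` consists of (at most) `i`
alternating possibly-empty blocks, starting with a block of `q`s. -/
def isAltFrom : Quant → ℕ → List Quant → Prop
  | _, 0, qs => qs = []
  | q, i + 1, qs => ∃ k rest, qs = List.replicate k q ++ rest ∧ isAltFrom q.neg i rest

/-- The prefix `P` is `Π_i`: its quantifier string lies in `∀*∃*∀*⋯` with `i`
alternating starred blocks beginning with `∀*`. -/
def isPiPrefix (i : ℕ) (P : List (Quant × ℕ)) : Prop :=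
  isAltFrom Quant.all i (P.map Prod.fst)

/-- The axiom set `H(Φ, Π_k)`: the clauses `C` on variables of `Φ` such that
some `Π_k`-relaxation of `Φ[assign(C)]` is false. -/
def Hset (Φ : QBC) (k : ℕ) : Set PA :=
  {C | (∀ v, C v ≠ none → v ∈ Φ.vars) ∧
    ∃ Φ' : QBC, IsRelaxation (Φ.inst C) Φ' ∧ isPiPrefix k Φ'.pfx ∧ Φ'.IsFalse}

/-- `g` is a semicompletion of `f` (relative to prefix `P`). -/
def SemiComp (P : List (Quant × ℕ)) (f g : PA) : Prop :=
  ExtendsPA g f ∧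
  ∀ y ∈ univVars P, f y = none → domPrec P f y → (g y = none ∧ domPrec P g y)

/-- A set of partial assignments of `Φ` is semicompletion-closed. -/
def SemiCompClosed (Φ : QBC) (H : Set PA) : Prop :=
  ∀ f ∈ H, ∀ g : PA, (∀ v, g v ≠ none → v ∈ Φ.vars) → SemiComp Φ.pfx f g → g ∈ H

/-- Delayer condition (semicompletion-of-empty). -/
def CondEmpty (Φ : QBC) (F : Set PA) (s : PA → ℕ) : Prop :=
  ∃ g ∈ F, SemiComp Φ.pfx emptyPA g ∧ s g = 0

/-- Delayer condition (monotonicity). -/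
def CondMono (Φ : QBC) (F : Set PA) (s : PA → ℕ) : Prop :=
  ∀ g ∈ F, ∀ f' : PA, ExtendsPA g f' → ∃ f ∈ F, SemiComp Φ.pfx f' f ∧ s f ≤ s g

/-- Delayer condition (∀-branching). -/
def CondForallB (Φ : QBC) (F : Set PA) (s : PA → ℕ) : Prop :=
  ∀ f ∈ F, ∀ y ∈ univVars Φ.pfx, f y = none → domPrec Φ.pfx f y →
    ∀ b : Bool, ∃ g ∈ F, SemiComp Φ.pfx (Function.update f y (some b)) g ∧ s g = s f

/-- Delayer condition (double-branching). -/
def CondDoubleB (Φ : QBC) (F : Set PA) (s : PA → ℕ) : Prop :=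
  ∀ f ∈ F, ∀ v ∈ Φ.vars, f v = none →
    ∃ b : Bool, ∃ g ∈ F, SemiComp Φ.pfx (Function.update f v (some b)) g ∧
      s g ≤ s f + 1 ∧
      (s g = s f + 1 →
        ∃ g' ∈ F, SemiComp Φ.pfx (Function.update f v (some (!b))) g' ∧ s g' ≤ s f + 1)

/-- A `p`-point delayer strategy for `Φ` with respect to axiom set `H`. -/
def IsDelayer (Φ : QBC) (H : Set PA) (p : ℕ) (F : Set PA) (s : PA → ℕ) : Prop :=
  (∀ f ∈ F, ∀ v, f v ≠ none → v ∈ Φ.vars) ∧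
  CondEmpty Φ F s ∧ (∀ f ∈ F, f ∈ H → p ≤ s f) ∧
  CondMono Φ F s ∧ CondForallB Φ F s ∧ CondDoubleB Φ F s

/-! The separation formulas `Φₙ` of Section 6. -/

/-- The variable `x_{i,j,k}`. -/
def xV (i : ℕ) (j k : Bool) : ℕ := 9 * i + 2 * cond j 1 0 + cond k 1 0

/-- The variable `x'_{i,j,k}`. -/
def xV' (i : ℕ) (j k : Bool) : ℕ := 9 * i + 4 + 2 * cond j 1 0 + cond k 1 0

/-- The variable `yᵢ`. -/
def yV (i : ℕ) : ℕ := 9 * i + 8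

/-- A block of four quantified variables. -/
def blockOf (q : Quant) (f : Bool → Bool → ℕ) : List (Quant × ℕ) :=
  [(q, f false false), (q, f false true), (q, f true false), (q, f true true)]

/-- The prefix `∃X₀ ∃X'₁∀y₁∃X₁ ⋯ ∃X'ₙ∀yₙ∃Xₙ`. -/
def sepPrefix (n : ℕ) : List (Quant × ℕ) :=
  blockOf Quant.ex (xV 0) ++
    (List.range n).flatMap fun i =>
      blockOf Quant.ex (xV' (i + 1)) ++ [(Quant.all, yV (i + 1))] ++
        blockOf Quant.ex (xV (i + 1))

/-- The clause `¬x_{0,j,k}` (as its falsifying assignment). -/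
def clB1 (j k : Bool) : PA := fun v => if v = xV 0 j k then some true else none

/-- The clause `x_{n,j,0} ∨ x_{n,j,1}`. -/
def clB2 (n : ℕ) (j : Bool) : PA :=
  fun v => if v = xV n j false ∨ v = xV n j true then some false else none

/-- The clause `¬x'_{i,0,k} ∨ ¬x'_{i,1,l} ∨ x_{i−1,j,0} ∨ x_{i−1,j,1}`. -/
def clH (i : ℕ) (j k l : Bool) : PA := fun v =>
  if v = xV' i false k ∨ v = xV' i true l then some true
  else if v = xV (i - 1) j false ∨ v = xV (i - 1) j true then some false
  else none

/-- For `j = false` the clause `¬x_{i,0,k} ∨ yᵢ ∨ x'_{i,0,k}`; for `j = true`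
the clause `¬x_{i,1,k} ∨ ¬yᵢ ∨ x'_{i,1,k}`. -/
def clT (i : ℕ) (j k : Bool) : PA := fun v =>
  if v = xV i j k then some true
  else if v = yV i then some j
  else if v = xV' i j k then some false
  else none

/-- The set `Tᵢ` of clauses. -/
def Tset (i : ℕ) : Set PA := {C | ∃ j k : Bool, C = clT i j k}

/-- The set of clauses of the matrix `φₙ`. -/
def sepClauses (n : ℕ) : Set PA :=
  {C | (∃ j k : Bool, C = clB1 j k) ∨ (∃ j : Bool, C = clB2 n j) ∨
    (∃ i, 1 ≤ i ∧ i ≤ n ∧ ∃ j k l : Bool, C = clH i j k l) ∨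
    (∃ i, 1 ≤ i ∧ i ≤ n ∧ ∃ j k : Bool, C = clT i j k)}

/-- The separation formula `Φₙ`. -/
def sepQBC (n : ℕ) : QBC :=
  ⟨sepPrefix n, fun g => ∀ C ∈ sepClauses n, ¬ TotalExtends g C⟩

/-- The level-`i` variables `X'ᵢ ∪ {yᵢ} ∪ Xᵢ`. -/
def levelVars (i : ℕ) : List ℕ :=
  [xV' i false false, xV' i false true, xV' i true false, xV' i true true, yV i,
   xV i false false, xV i false true, xV i true false, xV i true true]

/-- `r` is defined exactly on the level-`i` variables. -/
def OnLevel (i : ℕ) (r : PA) : Prop := ∀ v, r v ≠ none ↔ v ∈ levelVars i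

/-- A normal realization of level `i`. -/
def NormalReal (i : ℕ) (r : PA) : Prop :=
  OnLevel i r ∧ ∃ b : Bool, r (yV i) = some b ∧
    r (xV i b false) = some false ∧ r (xV' i b false) = some false ∧
    r (xV i b true) = some false ∧ r (xV' i b true) = some false ∧
    ∃ c : Bool, r (xV i (!b) false) = some c ∧ r (xV' i (!b) false) = some c ∧
      r (xV i (!b) true) = some (!c) ∧ r (xV' i (!b) true) = some (!c)

/-- A funny realization of level `i`. -/
def FunnyReal (i : ℕ) (r : PA) : Prop :=
  OnLevel i r ∧ ∃ b : Bool, r (yV i) = some b ∧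
    (∃ c : Bool, r (xV i b false) = some c ∧ r (xV' i b false) = some c ∧
      r (xV i b true) = some (!c) ∧ r (xV' i b true) = some (!c)) ∧
    r (xV' i (!b) false) = some false ∧ r (xV' i (!b) true) = some false ∧
    ∃ d : Bool, r (xV i (!b) false) = some d ∧ r (xV i (!b) true) = some (!d)

/-- Restriction of a partial assignment to the level-`i` variables. -/
def restrictLevel (i : ℕ) (f : PA) : PA :=
  fun v => if v ∈ levelVars i then f v else none

-- The maximum level `ℓ` containing an existentially quantified variable of
-- `dom f` (and `0` if there is none).
open Classical in
noncomputable def maxLevel (n : ℕ) (f : PA) : ℕ :=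
  ((Finset.Icc 1 n).filter fun i => ∃ v ∈ levelVars i, v ≠ yV i ∧ f v ≠ none).sup id

/-- `f` is half-defined on level `ℓ`. -/
def HalfDefined (ℓ : ℕ) (f : PA) : Prop :=
  (∀ j k : Bool, f (xV ℓ j k) = none) ∧
  (∃ j k : Bool, f (xV' ℓ j k) = some true ∧
    ∀ j' k' : Bool, (j', k') ≠ (j, k) → f (xV' ℓ j' k') = some false)

/-- A normal assignment of `Φₙ`. -/
def NormalAssign (n : ℕ) (f : PA) : Prop :=
  (∀ v, f v ≠ none → v ∈ (sepPrefix n).map Prod.snd) ∧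
  (∀ j k : Bool, f (xV 0 j k) = some false) ∧
  (∀ i, 1 ≤ i → i + 1 ≤ maxLevel n f → NormalReal i (restrictLevel i f)) ∧
  (1 ≤ maxLevel n f →
    (NormalReal (maxLevel n f) (restrictLevel (maxLevel n f) f) ∨
      HalfDefined (maxLevel n f) f))

/-- A funny assignment of `Φₙ`, with witness `m` (so that `sₙ(f) = m`). -/
def FunnyAssign (n : ℕ) (f : PA) (m : ℕ) : Prop :=
  (∀ v, f v ≠ none → v ∈ (sepPrefix n).map Prod.snd) ∧
  1 ≤ m ∧ m ≤ maxLevel n f ∧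
  (∀ j k : Bool, f (xV 0 j k) = some false) ∧
  (∀ i, 1 ≤ i → i < m → NormalReal i (restrictLevel i f)) ∧
  FunnyReal m (restrictLevel m f) ∧
  (∀ i, m < i → i ≤ maxLevel n f → ∀ j : Bool,
    ((f (xV i j false) ≠ none ∨ f (xV i j true) ≠ none ∨
      f (xV' i j false) ≠ none ∨ f (xV' i j true) ≠ none) →
      ∃ c : Bool, f (xV i j false) = some c ∧ f (xV' i j false) = some c ∧
        f (xV i j true) = some (!c) ∧ f (xV' i j true) = some (!c)))

/-- The set `Fₙ` of normal and funny assignments. -/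
def Fset (n : ℕ) : Set PA := {f | NormalAssign n f ∨ ∃ m, FunnyAssign n f m}

-- The score function `sₙ`.
open Classical in
noncomputable def score (n : ℕ) (f : PA) : ℕ :=
  if h : ∃ m, FunnyAssign n f m then h.choose else maxLevel n f

/-! The mod-3 formulas `Ψₙ` of Section 7 (variables `xᵢ = 2i`, `yᵢ = 2i+1`). -/

/-- The prefix `∃x₁∀y₁⋯∃xₙ∀yₙ`. -/
def modPrefix (n : ℕ) : List (Quant × ℕ) :=
  (List.range n).flatMap fun i =>
    [(Quant.ex, 2 * (i + 1)), (Quant.all, 2 * (i + 1) + 1)]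

/-- Numeric value of a Boolean. -/
def boolVal (b : Bool) : ℕ := cond b 1 0

/-- The matrix `φ_{n,j}`: true iff `j + Σᵢ (xᵢ + yᵢ) ≢ n (mod 3)`. -/
def modMatrix (n j : ℕ) (g : ℕ → Bool) : Prop :=
  ¬ ((j + ∑ i ∈ Finset.Icc 1 n, (boolVal (g (2 * i)) + boolVal (g (2 * i + 1)))) % 3
      = n % 3)

/-- The mod-3 formula `Ψₙ`. -/
def modQBC (n : ℕ) : QBC := ⟨modPrefix n, modMatrix n 0⟩


theorem isAltFrom_sublist : ∀ (i : ℕ) (q : Quant) (s t : List Quant), s.Sublist t →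
    isAltFrom q i t → isAltFrom q i s
  | 0, q, s, t, h, ht => by
    simp only [isAltFrom] at ht ⊢
    subst ht
    exact List.sublist_nil.mp h
  | i + 1, q, s, t, h, ht => by
    simp only [isAltFrom] at ht ⊢
    obtain ⟨k, rest, rfl, hr⟩ := ht
    obtain ⟨l₁, l₂, rfl, h1, h2⟩ := List.sublist_append_iff.mp h
    obtain ⟨n, _, rfl⟩ := List.sublist_replicate_iff.mp h1
    exact ⟨n, l₂, rfl, isAltFrom_sublist i _ _ _ h2 hr⟩

theorem pair_sublist_iff {α : Type*} (P : List α) (a b : α) :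
    [a, b].Sublist P ↔ ∃ i j : ℕ, i < j ∧ P[i]? = some a ∧ P[j]? = some b := by
  induction P with
  | nil => simp
  | cons c P ih =>
    constructor
    · intro h
      cases h with
      | cons _ h =>
        obtain ⟨i, j, hij, hi, hj⟩ := ih.mp h
        exact ⟨i + 1, j + 1, by omega, by simpa using hi, by simpa using hj⟩
      | cons_cons _ h =>
        have : b ∈ P := List.singleton_sublist.mp h
        obtain ⟨j, hj⟩ := List.mem_iff_getElem?.mp this
        exact ⟨0, j + 1, by omega, by simp, by simpa using hj⟩
    · rintro ⟨i, j, hij, hi, hj⟩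
      obtain ⟨j, rfl⟩ : ∃ j', j = j' + 1 := ⟨j - 1, by omega⟩
      rw [List.getElem?_cons_succ] at hj
      cases i with
      | zero =>
        simp only [List.getElem?_cons_zero, Option.some.injEq] at hi
        subst hi
        exact List.Sublist.cons_cons _ (List.singleton_sublist.mpr (List.mem_iff_getElem?.mpr ⟨j, hj⟩))
      | succ i =>
        rw [List.getElem?_cons_succ] at hi
        exact List.Sublist.cons _ (ih.mpr ⟨i, j, by omega, hi, hj⟩)

theorem eq_of_snd {P : List (Quant × ℕ)} (hP : (P.map Prod.snd).Nodup) {p q : Quant × ℕ}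
    (hp : p ∈ P) (hq : q ∈ P) (h : p.2 = q.2) : p = q :=
  List.inj_on_of_nodup_map hP hp hq h

theorem preceq_iff_sublist {P : List (Quant × ℕ)} (hP : (P.map Prod.snd).Nodup) {y x : ℕ}
    (hy : (Quant.all, y) ∈ P) (hx : (Quant.ex, x) ∈ P) :
    preceq P y x ↔ [(Quant.all, y), (Quant.ex, x)].Sublist P := by
  rw [pair_sublist_iff]
  constructor
  · rintro ⟨i, j, hi, hj, h⟩
    obtain ⟨p, hp, hp2⟩ := Option.map_eq_some_iff.mp hi
    obtain ⟨q, hq, hq2⟩ := Option.map_eq_some_iff.mp hj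
    have e1 : p = (Quant.all, y) := eq_of_snd hP (List.mem_iff_getElem?.mpr ⟨i, hp⟩) hy hp2
    have e2 : q = (Quant.ex, x) := eq_of_snd hP (List.mem_iff_getElem?.mpr ⟨j, hq⟩) hx hq2
    subst e1 e2
    refine ⟨i, j, ?_, hp, hq⟩
    rcases h with h | ⟨h, h'⟩
    · rcases h.lt_or_eq with h | h
      · exact h
      · subst h
        simp [hp] at hq
    · have := h' i h.le le_rfl
      simp [hp, hq] at this
  · rintro ⟨i, j, hij, hi, hj⟩
    exact ⟨i, j, by simp [hi], by simp [hj], Or.inl hij.le⟩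

theorem mem_univVars {P : List (Quant × ℕ)} {y : ℕ} : y ∈ univVars P ↔ (Quant.all, y) ∈ P := by
  simp [univVars]

theorem mem_existVars {P : List (Quant × ℕ)} {y : ℕ} : y ∈ existVars P ↔ (Quant.ex, y) ∈ P := by
  simp [existVars]

theorem preceq_total {P : List (Quant × ℕ)} {u v : ℕ} (hu : u ∈ P.map Prod.snd)
    (hv : v ∈ P.map Prod.snd) : preceq P u v ∨ preceq P v u := by
  obtain ⟨i, hi⟩ := List.mem_iff_getElem?.mp hu
  obtain ⟨j, hj⟩ := List.mem_iff_getElem?.mp hv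
  rw [List.getElem?_map] at hi hj
  rcases le_total i j with h | h
  · exact Or.inl ⟨i, j, hi, hj, Or.inl h⟩
  · exact Or.inr ⟨j, i, hj, hi, Or.inl h⟩

/-- A variable not strictly preceding any variable of `dom f` is preceded by `dom f`. -/
theorem domPrec_of_not {P : List (Quant × ℕ)} {f : PA} {y : ℕ}
    (hf : ∀ v, f v ≠ none → v ∈ P.map Prod.snd) (hy : y ∈ P.map Prod.snd)
    (h : ¬ ∃ u, f u ≠ none ∧ strictPrec P y u) : domPrec P f y := by
  intro u hu
  by_contra hn
  exact h ⟨u, hu, (preceq_total hy (hf u hu)).resolve_right hn, hn⟩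

theorem none_of_ext {f g : PA} (h : ExtendsPA g f) {v : ℕ} (hv : g v = none) : f v = none := by
  cases hf : f v with
  | none => rfl
  | some b => rw [h v b hf] at hv; cases hv

theorem ne_none_of_ext {f g : PA} (h : ExtendsPA g f) {v : ℕ} (hv : f v ≠ none) : g v ≠ none :=
  fun h' => hv (none_of_ext h h')

theorem instPrefix_semi {P : List (Quant × ℕ)} {f g : PA}
    (hf : ∀ v, f v ≠ none → v ∈ P.map Prod.snd) (h : SemiComp P f g) :
    instPrefix P g = (instPrefix P f).filter fun p => (g p.2).isNone := by
  unfold instPrefix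
  rw [List.filter_map, List.filter_filter]
  have e : (P.filter fun a => (((fun p : Quant × ℕ => (g p.2).isNone) ∘ fun p : Quant × ℕ =>
      (open Classical in if ∃ u, f u ≠ none ∧ strictPrec P p.2 u then Quant.ex else p.1, p.2)) a
        && (f a.2).isNone)) = P.filter fun p => (g p.2).isNone := by
    apply List.filter_congr
    intro p _
    simp only [Function.comp]
    cases hg : g p.2 with
    | none => simp [none_of_ext h.1 hg]
    | some b => simp
  refine Eq.trans ?_ (congrArg _ e.symm)
  apply List.map_congr_left
  intro p hp
  obtain ⟨hp, hgp⟩ := List.mem_filter.mp hp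
  have hgn : g p.2 = none := by simpa using hgp
  obtain ⟨q, v⟩ := p
  cases q with
  | ex => simp
  | all =>
    by_cases hc : ∃ u, f u ≠ none ∧ strictPrec P v u
    · have hc' : ∃ u, g u ≠ none ∧ strictPrec P v u := by
        obtain ⟨u, hu, hs⟩ := hc
        exact ⟨u, ne_none_of_ext h.1 hu, hs⟩
      simp only [if_pos hc, if_pos hc']
    · have hd := domPrec_of_not hf (List.mem_map.mpr ⟨_, hp, rfl⟩) hc
      have hd' := (h.2 v (mem_univVars.mpr hp) (none_of_ext h.1 hgn) hd).2
      have hc' : ¬ ∃ u, g u ≠ none ∧ strictPrec P v u := by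
        rintro ⟨u, hu, hs⟩
        exact hs.2 (hd' u hu)
      simp only [if_neg hc, if_neg hc']

theorem removed_ex {P : List (Quant × ℕ)} {f g : PA}
    (hf : ∀ v, f v ≠ none → v ∈ P.map Prod.snd) (h : SemiComp P f g)
    {p : Quant × ℕ} (hp : p ∈ instPrefix P f) (hg : g p.2 ≠ none) : p.1 = Quant.ex := by
  unfold instPrefix at hp
  obtain ⟨⟨q, v⟩, hr, rfl⟩ := List.mem_map.mp hp
  obtain ⟨hr, hfr⟩ := List.mem_filter.mp hr
  have hfn : f v = none := by simpa using hfr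
  by_cases hc : ∃ u, f u ≠ none ∧ strictPrec P v u
  · simp only [if_pos hc]
  · simp only [if_neg hc]
    cases q with
    | ex => rfl
    | all =>
      have hd := domPrec_of_not hf (List.mem_map.mpr ⟨_, hr, rfl⟩) hc
      exact absurd (h.2 v (mem_univVars.mpr hr) hfn hd).1 hg

theorem instPrefix_nodup {P : List (Quant × ℕ)} (hP : (P.map Prod.snd).Nodup) (f : PA) :
    ((instPrefix P f).map Prod.snd).Nodup := by
  unfold instPrefix
  rw [List.map_map]
  exact hP.sublist (List.filter_sublist.map Prod.snd)

theorem mem_instPrefix {P : List (Quant × ℕ)} {f : PA} {v : ℕ} (hv : v ∈ P.map Prod.snd)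
    (hf : f v = none) : v ∈ (instPrefix P f).map Prod.snd := by
  unfold instPrefix
  rw [List.map_map]
  obtain ⟨p, hp, rfl⟩ := List.mem_map.mp hv
  exact List.mem_map.mpr ⟨p, List.mem_filter.mpr ⟨hp, by simp [hf]⟩, rfl⟩

theorem evalQ_filter {φ : (ℕ → Bool) → Prop} {f g : PA} (hext : ExtendsPA g f) :
    ∀ (P : List (Quant × ℕ)) (h h' : ℕ → Bool),
    (∀ p ∈ P, g p.2 ≠ none → p.1 = Quant.ex) →
    (∀ v, g v = none → h v = h' v) →
    (∀ v b, g v = some b → f v = none → v ∉ P.map Prod.snd → h' v = b) →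
    evalQ (P.filter fun p => (g p.2).isNone) (fun k => φ (override g k)) h →
    evalQ P (fun k => φ (override f k)) h'
  | [], h, h', _, h2, h3, he => by
    simp only [List.filter_nil, evalQ] at he ⊢
    have : override g h = override f h' := by
      funext v
      unfold override
      cases hg : g v with
      | none => simp [none_of_ext hext hg, h2 v hg]
      | some b =>
        cases hf : f v with
        | none => simp [h3 v b hg hf (by simp)]
        | some c =>
          have := hext v c hf
          rw [hg] at this
          simpa using this
    rwa [← this]
  | (q, w) :: P, h, h', h1, h2, h3, he => by
    have h1' : ∀ p ∈ P, g p.2 ≠ none → p.1 = Quant.ex := fun p hp =>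
      h1 p (List.mem_cons_of_mem _ hp)
    cases hg : g w with
    | some b =>
      have hq : q = Quant.ex := h1 (q, w) List.mem_cons_self (by simp [hg])
      subst hq
      rw [List.filter_cons_of_neg (by simp [hg])] at he
      refine ⟨b, evalQ_filter hext P h _ h1' ?_ ?_ he⟩
      · intro v hv
        have : v ≠ w := by rintro rfl; simp [hg] at hv
        rw [Function.update_of_ne this]
        exact h2 v hv
      · intro v c hv hfv hvP
        by_cases hvw : v = w
        · subst hvw
          rw [hg] at hv
          simpa using hv
        · rw [Function.update_of_ne hvw]
          exact h3 v c hv hfv (by simpa [hvw] using hvP)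
    | none =>
      rw [List.filter_cons_of_pos (by simp [hg])] at he
      have key : ∀ b, evalQ (P.filter fun p => (g p.2).isNone) (fun k => φ (override g k))
            (Function.update h w b) →
          evalQ P (fun k => φ (override f k)) (Function.update h' w b) := by
        intro b
        apply evalQ_filter hext P _ _ h1'
        · intro v hv
          by_cases hvw : v = w
          · subst hvw; simp
          · rw [Function.update_of_ne hvw, Function.update_of_ne hvw]
            exact h2 v hv
        · intro v c hv hfv hvP
          have hvw : v ≠ w := by rintro rfl; simp [hg] at hv
          rw [Function.update_of_ne hvw]
          exact h3 v c hv hfv (by simpa [hvw] using hvP)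
      cases q with
      | ex =>
        obtain ⟨b, hb⟩ := he
        exact ⟨b, key b hb⟩
      | all => exact fun b => key b (he b)

/-- Lemma 4.9: for every QBC `Φ` and every `m ≥ 2`, the set of
partial assignments `H(Φ, Π_m)` is semicompletion-closed. -/
theorem Hset_semicompletion_closed (Φ : QBC) (hΦ : Φ.WellFormed) (m : ℕ)
    (hm : 2 ≤ m) : SemiCompClosed Φ (Hset Φ m) := by
  rintro f ⟨hf, ⟨P', M⟩, ⟨⟨hperm, hrel⟩, hM⟩, hpi, hfalse⟩ g hg hsc
  have hnd : (Φ.pfx.map Prod.snd).Nodup := hΦ.1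
  simp only [QBC.inst] at hperm hrel hM
  subst hM
  have hndf := instPrefix_nodup hnd f
  have hndg := instPrefix_nodup hnd g
  have hnd' : (P'.map Prod.snd).Nodup := (hperm.map Prod.snd).nodup_iff.mp hndf
  have heq := instPrefix_semi hf hsc
  refine ⟨hg, ⟨P'.filter fun p => (g p.2).isNone, fun k => Φ.matrix (override g k)⟩,
    ⟨⟨?_, ?_⟩, rfl⟩, ?_, ?_⟩
  · simp only [QBC.inst]
    rw [heq]
    exact hperm.filter _
  · intro y hy x hx hyx
    simp only [QBC.inst] at hy hx hyx ⊢
    rw [mem_univVars] at hy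
    rw [mem_existVars] at hx
    rw [preceq_iff_sublist hndg hy hx] at hyx
    rw [heq] at hy hx hyx
    obtain ⟨hy, hgy⟩ := List.mem_filter.mp hy
    obtain ⟨hx, hgx⟩ := List.mem_filter.mp hx
    have h1 := hyx.trans List.filter_sublist
    have h2 := hrel y (mem_univVars.mpr hy) x (mem_existVars.mpr hx)
      ((preceq_iff_sublist hndf hy hx).mpr h1)
    have hy' := hperm.mem_iff.mp hy
    have hx' := hperm.mem_iff.mp hx
    rw [preceq_iff_sublist hnd' hy' hx'] at h2
    have h3 := h2.filter fun p => (g p.2).isNone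
    rw [List.filter_cons_of_pos (by exact hgy), List.filter_cons_of_pos (by exact hgx), List.filter_nil] at h3
    exact (preceq_iff_sublist (hnd'.sublist (List.filter_sublist.map Prod.snd))
      (List.mem_filter.mpr ⟨hy', hgy⟩) (List.mem_filter.mpr ⟨hx', hgx⟩)).mpr h3
  · exact isAltFrom_sublist m _ _ _ (List.filter_sublist.map Prod.fst) hpi
  · intro htrue
    apply hfalse
    intro h
    refine evalQ_filter hsc.1 P' h h ?_ (fun _ _ => rfl) ?_ (htrue h)
    · intro p hp hgp
      exact removed_ex hf hsc (hperm.mem_iff.mpr hp) hgp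
    · intro v b hgv hfv hv
      exact absurd ((hperm.map Prod.snd).mem_iff.mp
        (mem_instPrefix (hg v (by simp [hgv])) hfv)) hv
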